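/- Perturbation with side conditions: Let (W, d_W) and (V, d_V) be cochain complexes of modules over a commutative ring with a deformation retraction given by cochain maps ι : W → V, π : V → W and a degree −1 graded-linear map η : V → V with π ∘ ι = id_W and ι ∘ π − id_V = d_V ∘ η + η ∘ d_V. Let δ : V → V be a degree +1 graded-linear map with (d_V + δ)² = 0 and id_V − δ ∘ η invertible as a graded-linear endomorphism. Assume in addition that η ∘ ι = 0, that δ maps the image of ι into itself, and that δ ∘ η commutes with ι ∘ π. Then the perturbed maps of the Homological Perturbation Lemma simplify: ι' := ι + η(1 − δη)⁻¹δι equals ι, π' := π + π(1 − δη)⁻¹δη equals π, and the perturbed differential on W is d_W + π ∘ δ ∘ ι; moreover ι and π are cochain maps between (W, d_W + π∘δ∘ι) and (V, d_V + δ) and (d_W + π∘δ∘ι)² = 0. -/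

import Mathlib

/-!
# Statement 2: The Homological Perturbation Lemma with side conditions

Cochain complexes of modules over a commutative ring `R` are encoded as
`ℤ`-indexed families of modules together with differentials of degree `+1`
squaring to zero.  A degree `-1` graded-linear map `η` on `V` is encoded as a
family `η i : V (i+1) →ₗ[R] V i`, a degree `+1` graded-linear map `δ` as a
family `δ i : V i →ₗ[R] V (i+1)`, and the two-sided inverse of the degree-zero
graded endomorphism `id - δ ∘ η` as a family `g i : V (i+1) →ₗ[R] V (i+1)`.
-/

namespace Stmt2

variable {R : Type*} [CommRing R] {W V : ℤ → Type*}
  [∀ i, AddCommGroup (W i)] [∀ i, Module R (W i)]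
  [∀ i, AddCommGroup (V i)] [∀ i, Module R (V i)]

/-- The simplified perturbed differential `d_W + π ∘ δ ∘ ι` on `W`. -/
def dPert (dW : ∀ i, W i →ₗ[R] W (i + 1)) (π : ∀ i, V i →ₗ[R] W i)
    (ι : ∀ i, W i →ₗ[R] V i) (δ : ∀ i, V i →ₗ[R] V (i + 1)) (i : ℤ) :
    W i →ₗ[R] W (i + 1) :=
  dW i + (π (i + 1)).comp ((δ i).comp (ι i))

/-- **Perturbation with side conditions.** -/
theorem perturbation_with_side_conditions
    (dW : ∀ i, W i →ₗ[R] W (i + 1)) (dV : ∀ i, V i →ₗ[R] V (i + 1))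
    (ι : ∀ i, W i →ₗ[R] V i) (π : ∀ i, V i →ₗ[R] W i)
    (η : ∀ i, V (i + 1) →ₗ[R] V i)
    (δ : ∀ i, V i →ₗ[R] V (i + 1))
    (g : ∀ i, V (i + 1) →ₗ[R] V (i + 1))
    -- `(W, d_W)` and `(V, d_V)` are cochain complexes:
    (hdW : ∀ i, (dW (i + 1)).comp (dW i) = 0)
    (hdV : ∀ i, (dV (i + 1)).comp (dV i) = 0)
    -- `ι` and `π` are cochain maps:
    (hι : ∀ i, (dV i).comp (ι i) = (ι (i + 1)).comp (dW i))
    (hπ : ∀ i, (dW i).comp (π i) = (π (i + 1)).comp (dV i))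
    -- deformation retraction:
    (hπι : ∀ i, (π i).comp (ι i) = LinearMap.id)
    (hhtpy : ∀ i, (ι (i + 1)).comp (π (i + 1)) - LinearMap.id =
      (dV i).comp (η i) + (η (i + 1)).comp (dV (i + 1)))
    -- `δ` is a perturbation: `(d_V + δ)² = 0`:
    (hδ : ∀ i, (dV (i + 1) + δ (i + 1)).comp (dV i + δ i) = 0)
    -- `id - δ ∘ η` is invertible, with two-sided inverse `g`:
    (hg₁ : ∀ i, (LinearMap.id - (δ i).comp (η i)).comp (g i) = LinearMap.id)
    (hg₂ : ∀ i, (g i).comp (LinearMap.id - (δ i).comp (η i)) = LinearMap.id)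
    -- side condition: `η ∘ ι = 0`:
    (hηι : ∀ i, (η i).comp (ι (i + 1)) = 0)
    -- side condition: `δ` maps the image of `ι` into itself:
    (hδι : ∀ i, LinearMap.range ((δ i).comp (ι i)) ≤ LinearMap.range (ι (i + 1)))
    -- side condition: `δ ∘ η` commutes with `ι ∘ π`:
    (hcomm : ∀ i, ((δ i).comp (η i)).comp ((ι (i + 1)).comp (π (i + 1))) =
      ((ι (i + 1)).comp (π (i + 1))).comp ((δ i).comp (η i))) :
    -- the perturbed inclusion `ι' = ι + η (1 - δη)⁻¹ δ ι` equals `ι`: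
    (∀ i, ι i + (η i).comp ((g i).comp ((δ i).comp (ι i))) = ι i) ∧
    -- the perturbed projection `π' = π + π (1 - δη)⁻¹ δ η` equals `π`:
    (∀ i, π (i + 1) + (π (i + 1)).comp ((g i).comp ((δ i).comp (η i))) = π (i + 1)) ∧
    -- the perturbed differential `δ_W = π (1 - δη)⁻¹ δ ι` on `W` is `π ∘ δ ∘ ι`:
    (∀ i, (π (i + 1)).comp ((g i).comp ((δ i).comp (ι i))) =
      (π (i + 1)).comp ((δ i).comp (ι i))) ∧
    -- `(d_W + π ∘ δ ∘ ι)² = 0`: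
    (∀ i, (dPert dW π ι δ (i + 1)).comp (dPert dW π ι δ i) = 0) ∧
    -- `ι` is a cochain map `(W, d_W + πδι) → (V, d_V + δ)`:
    (∀ i, (dV i + δ i).comp (ι i) = (ι (i + 1)).comp (dPert dW π ι δ i)) ∧
    -- `π` is a cochain map `(V, d_V + δ) → (W, d_W + πδι)`:
    (∀ i, (dPert dW π ι δ i).comp (π i) = (π (i + 1)).comp (dV i + δ i)) := by
  simp only [LinearMap.ext_iff, LinearMap.comp_apply, LinearMap.add_apply, LinearMap.sub_apply,
    LinearMap.id_apply, LinearMap.zero_apply, map_sub, map_add] at *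
  have hδι_eq : ∀ i w, δ i (ι i w) = ι (i + 1) (π (i + 1) (δ i (ι i w))) := by
    intro i w
    obtain ⟨w', hw'⟩ := hδι i ⟨w, rfl⟩
    rw [LinearMap.comp_apply] at hw'
    rw [← hw', hπι]
  have hgι : ∀ i w, g i (ι (i + 1) w) = ι (i + 1) w := by
    intro i w
    have h := hg₂ i (ι (i + 1) w)
    rwa [hηι, map_zero, map_zero, sub_zero] at h
  have hπδη : ∀ i v, π (i + 1) (δ i (η i v)) = 0 := by
    intro i v
    have h := congrArg (π (i + 1)) (hcomm i v)
    rw [hηι, map_zero, map_zero, hπι] at h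
    exact h.symm
  have hπg : ∀ i v, π (i + 1) (g i v) = π (i + 1) v := by
    intro i v
    have h := congrArg (π (i + 1)) (hg₁ i v)
    rwa [map_sub, hπδη, sub_zero] at h
  -- `πδιπ - πδ` is fixed by precomposition with `δη`, hence vanishes.
  have hπδ : ∀ i v, π (i + 1) (δ i (ι i (π i v))) = π (i + 1) (δ i v) := by
    intro i
    obtain ⟨j, rfl⟩ : ∃ j, i = j + 1 := ⟨i - 1, by ring⟩
    have hfix : ∀ v, π (j + 1 + 1) (δ (j + 1) (ι (j + 1) (π (j + 1) v))) -
        π (j + 1 + 1) (δ (j + 1) v) =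
        -π (j + 1 + 1) (δ (j + 1) (δ j (η j v))) := by
      intro v
      have h := congrArg (fun x => π (j + 1 + 1) (δ (j + 1) x)) (hhtpy j v)
      have h' := congrArg (π (j + 1 + 1)) (hδ j (η j v))
      simp only [map_sub, map_add, map_zero, hπδη, hdV, ← hπ, add_zero, zero_add] at h h'
      rw [h]
      exact eq_neg_of_add_eq_zero_left h'
    intro v
    have h₁ := hfix (g j v)
    have h₂ := congrArg (fun x => π (j + 1 + 1) (δ (j + 1) x)) (sub_eq_iff_eq_add.mp (hg₁ j v))
    simp only [map_add] at h₂
    rw [hπg, h₂] at h₁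
    rw [sub_eq_iff_eq_add.mp h₁]
    abel
  have hιchain : ∀ i w, dV i (ι i w) + δ i (ι i w) = ι (i + 1) (dPert dW π ι δ i w) := by
    intro i w
    simp only [dPert, LinearMap.add_apply, LinearMap.comp_apply, map_add]
    rw [hι, ← hδι_eq]
  refine ⟨fun i w => ?_, fun i v => ?_, fun i w => hπg i _, fun i w => ?_, hιchain,
    fun i v => ?_⟩
  · rw [hδι_eq, hgι, hηι, add_zero]
  · rw [hπg, hπδη, add_zero]
  · rw [← hπι (i + 1 + 1) (dPert dW π ι δ (i + 1) _), ← hιchain, ← hιchain]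
    rw [← map_zero (π (i + 1 + 1)), ← hδ i (ι i w)]
    simp only [map_add]
    abel
  · simp only [dPert, LinearMap.add_apply, LinearMap.comp_apply]
    rw [hπ, hπδ]

end Stmt2
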